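/- The function V is twice continuously differentiable on the open quadrant (0,∞)², extends continuously to [0,∞)² with value 0 on the coordinate axes, and on (0,∞)² it solves the Hamilton–Jacobi–Bellman equation (1/2)V_xx(x,y) + (1/2)V_yy(x,y) + V_xy(x,y) + max{V_x(x,y), V_y(x,y)} = 0. -/

import Mathlib

open MeasureTheory Set Filter

noncomputable def Phi (z : ℝ) : ℝ :=
  (Real.sqrt (2 * Real.pi))⁻¹ * ∫ u in Set.Iio z, Real.exp (-(u ^ 2) / 2)

open Classical in
/-- The explicit value function for `ρ = 1`, `δ = 0`, `μ̄ = 1`. -/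
noncomputable def Vfun (x y : ℝ) : ℝ :=
  if x = y then 1 - Real.exp (-x)
  else
    Phi (max x y / Real.sqrt |y - x|)
      - Real.exp (-2 * min x y) * Phi ((|y - x| - min x y) / Real.sqrt |y - x|)
      - Real.exp (-(x + y) / 2) * (2 * Phi (min x y / Real.sqrt |y - x|) - 1)

/-- Partial derivative of `Vfun` in the first variable. -/
noncomputable def Vx (x y : ℝ) : ℝ := deriv (fun x' => Vfun x' y) x

/-- Partial derivative of `Vfun` in the second variable. -/
noncomputable def Vy (x y : ℝ) : ℝ := deriv (fun y' => Vfun x y') y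

/-- Second partial derivative of `Vfun` in the first variable. -/
noncomputable def Vxx (x y : ℝ) : ℝ := deriv (fun x' => Vx x' y) x

/-- Second partial derivative of `Vfun` in the second variable. -/
noncomputable def Vyy (x y : ℝ) : ℝ := deriv (fun y' => Vy x y') y

/-- Mixed second partial derivative of `Vfun`. -/
noncomputable def Vxy (x y : ℝ) : ℝ := deriv (fun y' => Vx x y') y


open scoped Topology

/-- Standard normal density. -/
noncomputable def gphi (z : ℝ) : ℝ := (Real.sqrt (2 * Real.pi))⁻¹ * Real.exp (-(z ^ 2) / 2)

lemma gauss_integrable : Integrable (fun u : ℝ => Real.exp (-(u ^ 2) / 2)) := by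
  have h := integrable_exp_neg_mul_sq (b := 1 / 2) (by norm_num)
  refine h.congr (Filter.Eventually.of_forall fun u => ?_)
  simp only []
  congr 1
  ring

lemma gauss_total : ∫ u : ℝ, Real.exp (-(u ^ 2) / 2) = Real.sqrt (2 * Real.pi) := by
  have h := integral_gaussian (1 / 2)
  have e : Real.pi / (1 / 2) = 2 * Real.pi := by ring
  rw [e] at h
  rw [← h]
  congr 1
  ext u
  congr 1
  ring

lemma gauss_cont : Continuous (fun u : ℝ => Real.exp (-(u ^ 2) / 2)) := by fun_prop

lemma Phi_eq (z : ℝ) : Phi z = Phi 0 +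
    (Real.sqrt (2 * Real.pi))⁻¹ * ∫ u in (0 : ℝ)..z, Real.exp (-(u ^ 2) / 2) := by
  unfold Phi
  rw [← integral_Iic_eq_integral_Iio, ← integral_Iic_eq_integral_Iio,
    ← intervalIntegral.integral_Iic_sub_Iic gauss_integrable.integrableOn
      gauss_integrable.integrableOn]
  ring

lemma Phi_hasDerivAt (z : ℝ) : HasDerivAt Phi (gphi z) z := by
  have h := (gauss_cont.integral_hasStrictDerivAt 0 z).hasDerivAt
  have h2 := (h.const_mul (Real.sqrt (2 * Real.pi))⁻¹).const_add (Phi 0)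
  have e : Phi = fun z => Phi 0 +
    (Real.sqrt (2 * Real.pi))⁻¹ * ∫ u in (0 : ℝ)..z, Real.exp (-(u ^ 2) / 2) := by
    ext z; exact Phi_eq z
  rw [e]
  exact h2

lemma Phi_continuous : Continuous Phi :=
  continuous_iff_continuousAt.2 fun z => (Phi_hasDerivAt z).continuousAt

lemma sqrt2pi_pos : 0 < Real.sqrt (2 * Real.pi) := by positivity

lemma gphi_nonneg (z : ℝ) : 0 ≤ gphi z := by unfold gphi; positivity

lemma Phi_nonneg (z : ℝ) : 0 ≤ Phi z := by
  unfold Phi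
  have : 0 ≤ ∫ u in Set.Iio z, Real.exp (-(u ^ 2) / 2) :=
    integral_nonneg fun u => (Real.exp_pos _).le
  positivity

lemma Phi_neg (z : ℝ) : Phi (-z) = 1 - Phi z := by
  unfold Phi
  have h1 := integral_comp_neg_Ioi z (fun u : ℝ => Real.exp (-(u ^ 2) / 2))
  simp only [neg_sq] at h1
  have h2 := integral_add_compl (measurableSet_Iic (a := z)) gauss_integrable
  rw [gauss_total, compl_Iic, h1] at h2
  rw [← integral_Iic_eq_integral_Iio, ← integral_Iic_eq_integral_Iio]
  have h3 := inv_mul_cancel₀ sqrt2pi_pos.ne'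
  nth_rewrite 2 [← h2] at h3
  linarith

lemma Phi_le_one (z : ℝ) : Phi z ≤ 1 := by
  have := Phi_neg z
  have := Phi_nonneg (-z)
  linarith

lemma Phi_mono : Monotone Phi :=
  monotone_of_hasDerivAt_nonneg Phi_hasDerivAt gphi_nonneg

lemma Phi_zero : Phi 0 = 1 / 2 := by
  have := Phi_neg 0
  simp at this
  linarith

lemma Phi_tendsto : Tendsto Phi atBot (𝓝 0) := by
  have h := intervalIntegral_tendsto_integral_Iic (μ := volume) (f := fun u : ℝ => Real.exp (-(u ^ 2) / 2))
    0 gauss_integrable.integrableOn tendsto_id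
  have h2 := (h.const_mul (Real.sqrt (2 * Real.pi))⁻¹).const_sub (Phi 0)
  have e : Phi 0 - (Real.sqrt (2 * Real.pi))⁻¹ * ∫ u in Set.Iic (0 : ℝ), Real.exp (-(u ^ 2) / 2) = 0 := by
    unfold Phi
    rw [integral_Iic_eq_integral_Iio, sub_self]
  rw [e] at h2
  refine h2.congr fun z => ?_
  rw [Phi_eq z, intervalIntegral.integral_symm]
  simp

lemma gphi_hasDerivAt (z : ℝ) : HasDerivAt gphi (-z * gphi z) z := by
  unfold gphi
  have h : HasDerivAt (fun z : ℝ => -(z ^ 2) / 2) (-z) z := by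
    have := ((hasDerivAt_pow 2 z).neg).div_const 2
    refine this.congr_deriv ?_
    simp; ring
  refine (h.exp.const_mul _).congr_deriv ?_
  ring

lemma gphi_contDiff {n : WithTop ℕ∞} : ContDiff ℝ n gphi := by
  unfold gphi
  fun_prop

lemma pow_gphi_tendsto (k : ℕ) : Tendsto (fun z => z ^ k * gphi z) atTop (𝓝 0) := by
  have h := (Real.tendsto_pow_mul_exp_neg_atTop_nhds_zero k).const_mul (Real.sqrt (2 * Real.pi))⁻¹
  rw [mul_zero] at h
  refine squeeze_zero' ?_ ?_ h
  · filter_upwards [eventually_ge_atTop 0] with z hz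
    have := gphi_nonneg z
    positivity
  · filter_upwards [eventually_ge_atTop 2] with z hz
    unfold gphi
    have : Real.exp (-(z ^ 2) / 2) ≤ Real.exp (-z) := Real.exp_le_exp.2 (by nlinarith)
    have h1 : 0 ≤ (Real.sqrt (2 * Real.pi))⁻¹ := by positivity
    have h2 : 0 ≤ z ^ k := by positivity
    calc z ^ k * ((Real.sqrt (2 * Real.pi))⁻¹ * Real.exp (-(z ^ 2) / 2))
        = (Real.sqrt (2 * Real.pi))⁻¹ * (z ^ k * Real.exp (-(z ^ 2) / 2)) := by ring
      _ ≤ _ := by gcongr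

/-- Right half plane. -/
def HP : Set (ℝ × ℝ) := {p | 0 < p.1}

lemma HP_open : IsOpen HP := isOpen_lt continuous_const continuous_fst

/-- general flat gluing -/
lemma glue_cont (g : ℝ → ℝ) (hg : Continuous g) (hl : Tendsto g atTop (𝓝 0)) (p : ℝ × ℝ)
    (hp : p ∈ HP) :
    ContinuousAt (fun p : ℝ × ℝ => if 0 < p.2 then g (p.1 * (√p.2)⁻¹) else 0) p := by
  rcases lt_trichotomy p.2 0 with h | h | h
  · have : (fun p : ℝ × ℝ => if 0 < p.2 then g (p.1 * (√p.2)⁻¹) else 0) =ᶠ[𝓝 p] fun _ => 0 := by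
      filter_upwards [(isOpen_lt continuous_snd continuous_const).mem_nhds h] with q hq
      have hq : q.2 < 0 := hq
      rw [if_neg (by linarith)]
    exact continuousAt_const.congr this.symm
  · unfold ContinuousAt
    beta_reduce
    rw [if_neg (by rw [h]; exact lt_irrefl _)]
    apply Tendsto.if
    · have h1 : Tendsto (fun q : ℝ × ℝ => q.1) (𝓝 p ⊓ 𝓟 {q | 0 < q.2}) (𝓝 p.1) :=
        (continuous_fst.tendsto p).mono_left inf_le_left
      have h2 : Tendsto (fun q : ℝ × ℝ => √q.2) (𝓝 p ⊓ 𝓟 {q | 0 < q.2}) (𝓝[>] 0) := by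
        rw [tendsto_nhdsWithin_iff]
        constructor
        · have : Tendsto (fun q : ℝ × ℝ => √q.2) (𝓝 p) (𝓝 (√p.2)) :=
            (Real.continuous_sqrt.comp continuous_snd).tendsto p
          rw [h, Real.sqrt_zero] at this
          exact this.mono_left inf_le_left
        · filter_upwards [mem_inf_of_right (mem_principal_self _)] with q hq
          exact Real.sqrt_pos.2 hq
      exact hl.comp (h1.pos_mul_atTop hp (tendsto_inv_nhdsGT_zero.comp h2))
    · exact tendsto_const_nhds
  · have : (fun p : ℝ × ℝ => if 0 < p.2 then g (p.1 * (√p.2)⁻¹) else 0) =ᶠ[𝓝 p]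
        fun p => g (p.1 * (√p.2)⁻¹) := by
      filter_upwards [(isOpen_lt continuous_const continuous_snd).mem_nhds h] with q hq
      have hq : 0 < q.2 := hq
      rw [if_pos hq]
    refine ContinuousAt.congr ?_ this.symm
    refine hg.continuousAt.comp ?_
    refine continuousAt_fst.mul ?_
    refine ContinuousAt.inv₀ ?_ (Real.sqrt_pos.2 h).ne'
    exact (Real.continuous_sqrt.comp continuous_snd).continuousAt

noncomputable def RR (k : ℕ) (s t : ℝ) : ℝ := ((√t)⁻¹) ^ k * gphi (s * (√t)⁻¹)

noncomputable def KK (s t : ℝ) : ℝ := if 0 < t then Phi (-(s * (√t)⁻¹)) else 0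

lemma KK_cont (p : ℝ × ℝ) (hp : p ∈ HP) : ContinuousAt (fun p : ℝ × ℝ => KK p.1 p.2) p :=
  glue_cont (fun z => Phi (-z)) (Phi_continuous.comp continuous_neg)
    (Phi_tendsto.comp tendsto_neg_atTop_atBot) p hp

lemma RR_nonpos (k : ℕ) (s t : ℝ) (ht : t ≤ 0) : RR (k + 1) s t = 0 := by
  unfold RR
  rw [Real.sqrt_eq_zero_of_nonpos ht]
  simp

lemma RR_cont (k : ℕ) (p : ℝ × ℝ) (hp : p ∈ HP) :
    ContinuousAt (fun p : ℝ × ℝ => RR (k + 1) p.1 p.2) p := by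
  have h := glue_cont (fun z => z ^ (k + 1) * gphi z)
    ((continuous_id.pow _).mul (gphi_contDiff (n := 0)).continuous) (pow_gphi_tendsto _) p hp
  have h2 : ContinuousAt (fun p : ℝ × ℝ => (p.1 ^ (k + 1))⁻¹) p :=
    ContinuousAt.inv₀ (continuousAt_fst.pow _) (pow_ne_zero _ (ne_of_gt hp))
  refine (h2.mul h).congr ?_
  filter_upwards [HP_open.mem_nhds hp] with q hq
  have hq : 0 < q.1 := hq
  simp only [Pi.mul_apply]
  split_ifs with h
  · simp only [RR, mul_pow]
    field_simp
  · rw [RR_nonpos _ _ _ (not_lt.1 h), mul_zero]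

lemma rinv_deriv (t : ℝ) (ht : 0 < t) :
    HasDerivAt (fun t => (√t)⁻¹) (-((√t)⁻¹) ^ 3 / 2) t := by
  have h := (Real.hasDerivAt_sqrt ht.ne').inv (Real.sqrt_pos.2 ht).ne'
  refine h.congr_deriv ?_
  have := Real.sqrt_pos.2 ht
  field_simp

lemma RR_ds (k : ℕ) (s t : ℝ) : HasDerivAt (fun s => RR k s t) (-s * RR (k + 2) s t) s := by
  unfold RR
  have h1 : HasDerivAt (fun s : ℝ => s * (√t)⁻¹) ((√t)⁻¹) s := by
    simpa using (hasDerivAt_id s).mul_const ((√t)⁻¹)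
  refine (((gphi_hasDerivAt _).comp s h1).const_mul _).congr_deriv ?_
  ring

lemma RR_dt_pos (k : ℕ) (s t : ℝ) (ht : 0 < t) : HasDerivAt (fun t => RR (k + 1) s t)
    (-((k + 1 : ℕ) : ℝ) / 2 * RR (k + 3) s t + s ^ 2 / 2 * RR (k + 5) s t) t := by
  unfold RR
  have h1 := rinv_deriv t ht
  have h2 := (h1.fun_pow (k + 1)).mul ((gphi_hasDerivAt _).comp t (h1.const_mul s))
  refine h2.congr_deriv ?_
  simp only [Function.comp, Nat.add_sub_cancel]
  ring

lemma RR_dt (k : ℕ) (s t : ℝ) (hs : 0 < s) : HasDerivAt (fun t => RR (k + 1) s t)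
    (-((k + 1 : ℕ) : ℝ) / 2 * RR (k + 3) s t + s ^ 2 / 2 * RR (k + 5) s t) t := by
  have c : ∀ j, ContinuousAt (fun t => RR (j + 1) s t) 0 := fun j =>
    ContinuousAt.comp (f := fun t : ℝ => (s, t)) (RR_cont j (s, 0) hs) (by fun_prop)
  refine hasDerivAt_of_hasDerivAt_of_ne' (f := fun t => RR (k + 1) s t)
    (g := fun t => -((k + 1 : ℕ) : ℝ) / 2 * RR (k + 3) s t + s ^ 2 / 2 * RR (k + 5) s t)
    (x := 0) ?_ (c k) ((continuousAt_const.mul (c (k + 2))).add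
      (continuousAt_const.mul (c (k + 4)))) t
  intro t ht
  rcases lt_or_gt_of_ne ht with h | h
  · rw [RR_nonpos (k + 2) s t h.le, RR_nonpos (k + 4) s t h.le]
    simp only [mul_zero, add_zero]
    refine (hasDerivAt_const t (0 : ℝ)).congr_of_eventuallyEq ?_
    filter_upwards [Iio_mem_nhds h] with u hu
    exact RR_nonpos k s u (le_of_lt hu)
  · exact RR_dt_pos k s t h

lemma KK_ds (s t : ℝ) : HasDerivAt (fun s => KK s t) (- RR 1 s t) s := by
  unfold KK
  split_ifs with h
  · have h1 : HasDerivAt (fun s : ℝ => -(s * (√t)⁻¹)) (-(√t)⁻¹) s := by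
      simpa using ((hasDerivAt_id s).mul_const ((√t)⁻¹)).fun_neg
    refine ((Phi_hasDerivAt _).comp s h1).congr_deriv ?_
    simp only [RR, gphi, neg_sq]
    ring
  · rw [RR_nonpos 0 s t (not_lt.1 h), neg_zero]
    exact hasDerivAt_const _ _

lemma KK_dt (s t : ℝ) (hs : 0 < s) : HasDerivAt (fun t => KK s t) (s / 2 * RR 3 s t) t := by
  have c : ContinuousAt (fun t => RR (2 + 1) s t) 0 :=
    ContinuousAt.comp (f := fun t : ℝ => (s, t)) (RR_cont 2 (s, 0) hs) (by fun_prop)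
  have c0 : ContinuousAt (fun t => KK s t) 0 :=
    ContinuousAt.comp (f := fun t : ℝ => (s, t)) (KK_cont (s, 0) hs) (by fun_prop)
  refine hasDerivAt_of_hasDerivAt_of_ne' (f := fun t => KK s t)
    (g := fun t => s / 2 * RR 3 s t) (x := 0) ?_ c0 (continuousAt_const.mul c) t
  intro t ht
  rcases lt_or_gt_of_ne ht with h | h
  · rw [RR_nonpos 2 s t h.le, mul_zero]
    refine (hasDerivAt_const t (0 : ℝ)).congr_of_eventuallyEq ?_
    filter_upwards [Iio_mem_nhds h] with u hu
    exact if_neg (not_lt.2 (le_of_lt hu))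
  · have h1 := ((rinv_deriv t h).const_mul s).fun_neg
    have h2 := (Phi_hasDerivAt _).comp t h1
    have h3 : HasDerivAt (fun t => Phi (-(s * (√t)⁻¹))) (s / 2 * RR 3 s t) t := by
      refine h2.congr_deriv ?_
      simp only [RR, gphi, neg_sq]
      ring
    refine h3.congr_of_eventuallyEq ?_
    filter_upwards [Ioi_mem_nhds h] with u hu
    exact if_pos hu

/-- partial derivatives criterion -/
lemma contDiff_partial (n : ℕ) (U : Set (ℝ × ℝ)) (hU : IsOpen U) (f f1 f2 : ℝ → ℝ → ℝ)
    (h1 : ∀ p ∈ U, HasDerivAt (fun s => f s p.2) (f1 p.1 p.2) p.1)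
    (h2 : ∀ p ∈ U, HasDerivAt (fun t => f p.1 t) (f2 p.1 p.2) p.2)
    (c1 : ContDiffOn ℝ n (fun p : ℝ × ℝ => f1 p.1 p.2) U)
    (c2 : ContDiffOn ℝ n (fun p : ℝ × ℝ => f2 p.1 p.2) U) :
    ContDiffOn ℝ (n + 1 : ℕ) (fun p : ℝ × ℝ => f p.1 p.2) U := by
  have key : ∀ p ∈ U, HasFDerivAt (fun p : ℝ × ℝ => f p.1 p.2)
      (f1 p.1 p.2 • ContinuousLinearMap.fst ℝ ℝ ℝ + f2 p.1 p.2 • ContinuousLinearMap.snd ℝ ℝ ℝ) p := by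
    intro p hp
    have := hasStrictFDerivAt_uncurry_coprod (𝕜 := ℝ) (u := p) (f := f)
      (f₁ := fun s t => ContinuousLinearMap.toSpanSingleton ℝ (f1 s t))
      (f₂ := fun s t => ContinuousLinearMap.toSpanSingleton ℝ (f2 s t)) ?_ ?_ ?_ ?_
    · have := this.hasFDerivAt
      refine this.congr_fderiv ?_
      ext <;> simp [Function.HasUncurry.uncurry]
    · filter_upwards [hU.mem_nhds hp] with q hq
      exact (h1 q hq).hasFDerivAt
    · filter_upwards [hU.mem_nhds hp] with q hq
      exact (h2 q hq).hasFDerivAt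
    · exact ((ContinuousLinearMap.toSpanSingletonCLE (𝕜 := ℝ) (E := ℝ)).continuous.continuousAt).comp
        (c1.continuousOn.continuousAt (hU.mem_nhds hp))
    · exact ((ContinuousLinearMap.toSpanSingletonCLE (𝕜 := ℝ) (E := ℝ)).continuous.continuousAt).comp
        (c2.continuousOn.continuousAt (hU.mem_nhds hp))
  push_cast
  rw [contDiffOn_succ_iff_hasFDerivWithinAt_of_uniqueDiffOn hU.uniqueDiffOn]
  refine ⟨fun h => by simp at h, _, ?_, fun p hp => (key p hp).hasFDerivWithinAt⟩
  exact (c1.smul contDiffOn_const).add (c2.smul contDiffOn_const)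

lemma RR_contDiff (n : ℕ) : ∀ k, ContDiffOn ℝ n (fun p : ℝ × ℝ => RR (k + 1) p.1 p.2) HP := by
  induction n with
  | zero =>
    intro k
    simp only [Nat.cast_zero, contDiffOn_zero]
    exact fun p hp => (RR_cont k p hp).continuousWithinAt
  | succ n ih =>
    intro k
    refine contDiff_partial n HP HP_open (RR (k + 1)) (fun s t => -s * RR (k + 3) s t)
      (fun s t => -((k + 1 : ℕ) : ℝ) / 2 * RR (k + 3) s t + s ^ 2 / 2 * RR (k + 5) s t)
      (fun p hp => RR_ds _ _ _)
      (fun p hp => RR_dt _ _ _ hp) ?_ ?_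
    · exact (contDiff_fst.neg.contDiffOn).mul (ih (k + 2))
    · exact (contDiffOn_const.mul (ih (k + 2))).add
        (ContDiffOn.mul (contDiff_fst.pow 2 |>.div_const 2).contDiffOn (ih (k + 4)))

lemma KK_contDiff : ContDiffOn ℝ 2 (fun p : ℝ × ℝ => KK p.1 p.2) HP := by
  refine contDiff_partial 1 HP HP_open KK (fun s t => -RR 1 s t) (fun s t => s / 2 * RR 3 s t) (fun p hp => KK_ds _ _)
      (fun p hp => KK_dt _ _ hp) ?_ ?_
  · exact (RR_contDiff 1 0).neg
  · exact ContDiffOn.mul (contDiff_fst.div_const 2).contDiffOn (RR_contDiff 1 2)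

/-- The function on the region `x < y`. -/
noncomputable def WW (x y : ℝ) : ℝ :=
  Phi (y * (√(y - x))⁻¹) - Real.exp (-2 * x) * Phi ((y - 2 * x) * (√(y - x))⁻¹)
    - Real.exp (-(x + y) / 2) * (2 * Phi (x * (√(y - x))⁻¹) - 1)

noncomputable def W1 (x y : ℝ) : ℝ :=
  2 * (Real.exp (-2 * x) * Phi ((y - 2 * x) * (√(y - x))⁻¹))
    + 1 / 2 * (Real.exp (-(x + y) / 2) * (2 * Phi (x * (√(y - x))⁻¹) - 1))

noncomputable def W2 (x y : ℝ) : ℝ :=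
  1 / 2 * (Real.exp (-(x + y) / 2) * (2 * Phi (x * (√(y - x))⁻¹) - 1))

lemma Vfun_symm (x y : ℝ) : Vfun x y = Vfun y x := by
  unfold Vfun
  by_cases h : x = y
  · subst h; rfl
  · rw [if_neg h, if_neg (Ne.symm h), max_comm, min_comm, abs_sub_comm, add_comm]

lemma Vfun_lt (x y : ℝ) (h : x < y) : Vfun x y = WW x y := by
  unfold Vfun WW
  rw [if_neg h.ne, max_eq_right h.le, min_eq_left h.le, abs_of_pos (sub_pos.2 h),
    div_eq_mul_inv y, div_eq_mul_inv _ (√(y - x)), div_eq_mul_inv x]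
  have : y - x - x = y - 2 * x := by ring
  rw [this]

lemma Phi_contDiff : ContDiff ℝ 2 Phi := by
  have e : deriv Phi = gphi := funext fun z => (Phi_hasDerivAt z).deriv
  have : ContDiff ℝ (1 + 1) Phi := by
    rw [contDiff_succ_iff_deriv]
    refine ⟨fun z => (Phi_hasDerivAt z).differentiableAt, fun h => by simp at h, ?_⟩
    rw [e]
    exact gphi_contDiff
  simpa [one_add_one_eq_two] using this

lemma WW_contDiffAt (p : ℝ × ℝ) (h : p.1 < p.2) :
    ContDiffAt ℝ 2 (fun p : ℝ × ℝ => WW p.1 p.2) p := by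
  have h0 : p.2 - p.1 ≠ 0 := (sub_pos.2 h).ne'
  have hs : ContDiffAt ℝ 2 (fun p : ℝ × ℝ => (√(p.2 - p.1))⁻¹) p :=
    ((contDiff_snd.sub contDiff_fst).contDiffAt.sqrt h0).inv
      (Real.sqrt_pos.2 (sub_pos.2 h)).ne'
  have a1 : ContDiffAt ℝ 2 (fun p : ℝ × ℝ => Phi (p.2 * (√(p.2 - p.1))⁻¹)) p :=
    Phi_contDiff.contDiffAt.comp p (contDiffAt_snd.mul hs)
  have a2 : ContDiffAt ℝ 2 (fun p : ℝ × ℝ => Phi ((p.2 - 2 * p.1) * (√(p.2 - p.1))⁻¹)) p :=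
    Phi_contDiff.contDiffAt.comp p
      ((contDiffAt_snd.sub (contDiffAt_const.mul contDiffAt_fst)).mul hs)
  have a3 : ContDiffAt ℝ 2 (fun p : ℝ × ℝ => Phi (p.1 * (√(p.2 - p.1))⁻¹)) p :=
    Phi_contDiff.contDiffAt.comp p (contDiffAt_fst.mul hs)
  have e1 : ContDiffAt ℝ 2 (fun p : ℝ × ℝ => Real.exp (-2 * p.1)) p := by fun_prop
  have e2 : ContDiffAt ℝ 2 (fun p : ℝ × ℝ => Real.exp (-(p.1 + p.2) / 2)) p := by fun_prop
  exact (a1.sub (e1.mul a2)).sub (e2.mul ((contDiffAt_const.mul a3).sub contDiffAt_const))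

noncomputable def TT (x y : ℝ) : ℝ :=
  - KK y (y - x) - Real.exp (-2 * x) * KK (2 * x - y) (y - x)
    + 2 * (Real.exp (-(x + y) / 2) * KK x (y - x))

lemma TT_zero (x y : ℝ) (h : y ≤ x) : TT x y = 0 := by
  unfold TT KK
  simp [not_lt.2 h]

lemma WW_eq_TT (x y : ℝ) (h : x < y) : WW x y = 1 - Real.exp (-(x + y) / 2) + TT x y := by
  unfold TT KK WW
  rw [if_pos (sub_pos.2 h), if_pos (sub_pos.2 h), if_pos (sub_pos.2 h), Phi_neg, Phi_neg (x * _)]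
  have : -((2 * x - y) * (√(y - x))⁻¹) = (y - 2 * x) * (√(y - x))⁻¹ := by ring
  rw [this]
  ring

lemma Vfun_eq_TT (x y : ℝ) : Vfun x y = 1 - Real.exp (-(x + y) / 2) + TT x y + TT y x := by
  rcases lt_trichotomy x y with h | h | h
  · rw [Vfun_lt x y h, TT_zero y x h.le, WW_eq_TT x y h, add_zero]
  · subst h
    rw [TT_zero x x le_rfl, Vfun, if_pos rfl]
    have : -(x + x) / 2 = -x := by ring
    rw [this]
    ring
  · rw [Vfun_symm, Vfun_lt y x h, TT_zero x y h.le, WW_eq_TT y x h, add_zero, add_comm y x]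

lemma TT_contDiffAt (p : ℝ × ℝ) (h1 : 0 < p.1) (h2 : 0 < p.2) (h3 : p.2 < 2 * p.1) :
    ContDiffAt ℝ 2 (fun p : ℝ × ℝ => TT p.1 p.2) p := by
  have k : ∀ q ∈ HP, ContDiffAt ℝ 2 (fun p : ℝ × ℝ => KK p.1 p.2) q := fun q hq =>
    KK_contDiff.contDiffAt (HP_open.mem_nhds hq)
  have a1 : ContDiffAt ℝ 2 (fun p : ℝ × ℝ => KK p.2 (p.2 - p.1)) p :=
    (k (p.2, p.2 - p.1) h2).comp p (f := fun p : ℝ × ℝ => (p.2, p.2 - p.1)) (by fun_prop)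
  have a2 : ContDiffAt ℝ 2 (fun p : ℝ × ℝ => KK (2 * p.1 - p.2) (p.2 - p.1)) p :=
    (k (2 * p.1 - p.2, p.2 - p.1) (sub_pos.2 h3)).comp p
      (f := fun p : ℝ × ℝ => (2 * p.1 - p.2, p.2 - p.1)) (by fun_prop)
  have a3 : ContDiffAt ℝ 2 (fun p : ℝ × ℝ => KK p.1 (p.2 - p.1)) p :=
    (k (p.1, p.2 - p.1) h1).comp p (f := fun p : ℝ × ℝ => (p.1, p.2 - p.1)) (by fun_prop)
  have e1 : ContDiffAt ℝ 2 (fun p : ℝ × ℝ => Real.exp (-2 * p.1)) p := by fun_prop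
  have e2 : ContDiffAt ℝ 2 (fun p : ℝ × ℝ => Real.exp (-(p.1 + p.2) / 2)) p := by fun_prop
  exact (a1.neg.sub (e1.mul a2)).add (contDiffAt_const.mul (e2.mul a3))

lemma V_contDiff :
    ContDiffOn ℝ 2 (fun p : ℝ × ℝ => Vfun p.1 p.2) (Set.Ioi (0 : ℝ) ×ˢ Set.Ioi (0 : ℝ)) := by
  rintro p ⟨h1, h2⟩
  have h1 : 0 < p.1 := h1
  have h2 : 0 < p.2 := h2
  apply ContDiffAt.contDiffWithinAt
  rcases lt_trichotomy p.1 p.2 with h | h | h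
  · refine (WW_contDiffAt p h).congr_of_eventuallyEq ?_
    filter_upwards [(isOpen_lt continuous_fst continuous_snd).mem_nhds h] with q hq
    exact Vfun_lt _ _ hq
  · have e2 : ContDiffAt ℝ 2 (fun p : ℝ × ℝ => 1 - Real.exp (-(p.1 + p.2) / 2)) p := by fun_prop
    have t1 := TT_contDiffAt p h1 h2 (by linarith)
    have t2 : ContDiffAt ℝ 2 (fun p : ℝ × ℝ => TT p.2 p.1) p :=
      (TT_contDiffAt (p.2, p.1) h2 h1 (by simp only []; linarith)).comp p
        (f := fun p : ℝ × ℝ => (p.2, p.1)) (by fun_prop)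
    refine ((e2.add t1).add t2).congr_of_eventuallyEq ?_
    filter_upwards with q
    exact Vfun_eq_TT _ _
  · have := (WW_contDiffAt (p.2, p.1) h).comp p
        (f := fun p : ℝ × ℝ => (p.2, p.1)) (by fun_prop)
    refine this.congr_of_eventuallyEq ?_
    filter_upwards [(isOpen_lt continuous_snd continuous_fst).mem_nhds h] with q hq
    rw [Vfun_symm]
    exact Vfun_lt _ _ hq

lemma gphi_rel1 (x y : ℝ) (h : x < y) : gphi (y * (√(y - x))⁻¹)
    = Real.exp (-(x + y) / 2) * gphi (x * (√(y - x))⁻¹) := by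
  unfold gphi
  rw [mul_left_comm, ← Real.exp_add]
  congr 2
  have h0 : y - x ≠ 0 := (sub_pos.2 h).ne'
  rw [mul_pow, mul_pow, inv_pow, Real.sq_sqrt (sub_pos.2 h).le]
  field_simp
  ring

lemma gphi_rel2 (x y : ℝ) (h : x < y) :
    Real.exp (-2 * x) * gphi ((y - 2 * x) * (√(y - x))⁻¹)
    = Real.exp (-(x + y) / 2) * gphi (x * (√(y - x))⁻¹) := by
  unfold gphi
  rw [mul_left_comm, mul_left_comm (Real.exp (-(x + y) / 2)), ← Real.exp_add, ← Real.exp_add]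
  congr 2
  have h0 : y - x ≠ 0 := (sub_pos.2 h).ne'
  rw [mul_pow, mul_pow, inv_pow, Real.sq_sqrt (sub_pos.2 h).le]
  field_simp
  ring

lemma r_dx (x y : ℝ) (h : x < y) :
    HasDerivAt (fun x => (√(y - x))⁻¹) (((√(y - x))⁻¹) ^ 3 / 2) x := by
  have h1 : HasDerivAt (fun x => y - x) (-1) x := (hasDerivAt_id x).const_sub y
  refine ((rinv_deriv _ (sub_pos.2 h)).comp x h1).congr_deriv ?_
  ring

lemma r_dy (x y : ℝ) (h : x < y) :
    HasDerivAt (fun y => (√(y - x))⁻¹) (-((√(y - x))⁻¹) ^ 3 / 2) y := by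
  have h1 : HasDerivAt (fun y => y - x) 1 y := (hasDerivAt_id y).sub_const x
  refine ((rinv_deriv _ (sub_pos.2 h)).comp y h1).congr_deriv ?_
  ring

lemma r_sq (x y : ℝ) (h : x < y) : (y - x) * ((√(y - x))⁻¹) ^ 2 = 1 := by
  rw [inv_pow, Real.sq_sqrt (sub_pos.2 h).le]
  exact mul_inv_cancel₀ (sub_pos.2 h).ne'

section derivs
variable (x y : ℝ) (h : x < y)
include h

lemma A_dx : HasDerivAt (fun x => Phi (y * (√(y - x))⁻¹))
    ((Real.exp (-(x + y) / 2) * gphi (x * (√(y - x))⁻¹)) * (y * (((√(y - x))⁻¹) ^ 3 / 2))) x := by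
  rw [← gphi_rel1 x y h]
  exact (Phi_hasDerivAt _).comp x ((r_dx x y h).const_mul y)

lemma A_dy : HasDerivAt (fun y => Phi (y * (√(y - x))⁻¹))
    ((Real.exp (-(x + y) / 2) * gphi (x * (√(y - x))⁻¹)) *
      ((√(y - x))⁻¹ - y * (((√(y - x))⁻¹) ^ 3 / 2))) y := by
  rw [← gphi_rel1 x y h]
  refine ((Phi_hasDerivAt _).comp y ((hasDerivAt_id y).fun_mul (r_dy x y h))).congr_deriv ?_
  simp only [id]
  ring

lemma B_dx : HasDerivAt (fun x => Real.exp (-2 * x) * Phi ((y - 2 * x) * (√(y - x))⁻¹))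
    (-2 * (Real.exp (-2 * x) * Phi ((y - 2 * x) * (√(y - x))⁻¹)) +
      (Real.exp (-(x + y) / 2) * gphi (x * (√(y - x))⁻¹)) *
      (-2 * (√(y - x))⁻¹ + (y - 2 * x) * (((√(y - x))⁻¹) ^ 3 / 2))) x := by
  rw [← gphi_rel2 x y h]
  have e1 : HasDerivAt (fun x : ℝ => -2 * x) (-2) x := by
    simpa using (hasDerivAt_id x).const_mul (-2 : ℝ)
  have e2 : HasDerivAt (fun x : ℝ => y - 2 * x) (-2) x := by
    simpa using ((hasDerivAt_id x).const_mul (2 : ℝ)).const_sub y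
  refine (e1.exp.fun_mul ((Phi_hasDerivAt _).comp x (e2.fun_mul (r_dx x y h)))).congr_deriv ?_
  simp only [Function.comp]
  ring

lemma B_dy : HasDerivAt (fun y => Real.exp (-2 * x) * Phi ((y - 2 * x) * (√(y - x))⁻¹))
    ((Real.exp (-(x + y) / 2) * gphi (x * (√(y - x))⁻¹)) *
      ((√(y - x))⁻¹ - (y - 2 * x) * (((√(y - x))⁻¹) ^ 3 / 2))) y := by
  rw [← gphi_rel2 x y h]
  have e2 : HasDerivAt (fun y : ℝ => y - 2 * x) 1 y := (hasDerivAt_id y).sub_const _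
  refine (((Phi_hasDerivAt _).comp y (e2.fun_mul (r_dy x y h))).const_mul _).congr_deriv ?_
  ring

lemma C_dx : HasDerivAt (fun x => Real.exp (-(x + y) / 2) * (2 * Phi (x * (√(y - x))⁻¹) - 1))
    (-1 / 2 * (Real.exp (-(x + y) / 2) * (2 * Phi (x * (√(y - x))⁻¹) - 1)) +
      (Real.exp (-(x + y) / 2) * gphi (x * (√(y - x))⁻¹)) *
      (2 * (√(y - x))⁻¹ + x * (((√(y - x))⁻¹) ^ 3))) x := by
  have e1 : HasDerivAt (fun x : ℝ => -(x + y) / 2) (-1 / 2) x :=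
    (((hasDerivAt_id x).add_const y).fun_neg).div_const 2
  refine (e1.exp.fun_mul ((((Phi_hasDerivAt _).comp x
    ((hasDerivAt_id x).fun_mul (r_dx x y h))).const_mul 2).sub_const 1)).congr_deriv ?_
  simp only [Function.comp, id]
  ring

lemma C_dy : HasDerivAt (fun y => Real.exp (-(x + y) / 2) * (2 * Phi (x * (√(y - x))⁻¹) - 1))
    (-1 / 2 * (Real.exp (-(x + y) / 2) * (2 * Phi (x * (√(y - x))⁻¹) - 1)) +
      (Real.exp (-(x + y) / 2) * gphi (x * (√(y - x))⁻¹)) *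
      (- x * (((√(y - x))⁻¹) ^ 3))) y := by
  have e1 : HasDerivAt (fun y : ℝ => -(x + y) / 2) (-1 / 2) y :=
    (((hasDerivAt_id y).const_add x).fun_neg).div_const 2
  refine (e1.exp.fun_mul ((((Phi_hasDerivAt _).comp y
    ((r_dy x y h).const_mul x)).const_mul 2).sub_const 1)).congr_deriv ?_
  simp only [Function.comp]
  ring

lemma WW_dx : HasDerivAt (fun x => WW x y) (W1 x y) x := by
  refine (((A_dx x y h).fun_sub (B_dx x y h)).fun_sub (C_dx x y h)).congr_deriv ?_
  unfold W1
  ring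

lemma WW_dy : HasDerivAt (fun y => WW x y) (W2 x y) y := by
  refine (((A_dy x y h).fun_sub (B_dy x y h)).fun_sub (C_dy x y h)).congr_deriv ?_
  unfold W2
  ring

end derivs

/-- The common factor `E φ(c)`. -/
noncomputable def GG (x y : ℝ) : ℝ := Real.exp (-(x + y) / 2) * gphi (x * (√(y - x))⁻¹)

section derivs2
variable (x y : ℝ) (h : x < y)
include h

lemma W1_dx : HasDerivAt (fun x => W1 x y)
    (2 * (-2 * (Real.exp (-2 * x) * Phi ((y - 2 * x) * (√(y - x))⁻¹)) +
      GG x y * (-2 * (√(y - x))⁻¹ + (y - 2 * x) * (((√(y - x))⁻¹) ^ 3 / 2)))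
      + 1 / 2 * (-W2 x y + GG x y * (2 * (√(y - x))⁻¹ + x * (((√(y - x))⁻¹) ^ 3)))) x := by
  refine (((B_dx x y h).const_mul 2).fun_add ((C_dx x y h).const_mul (1 / 2))).congr_deriv ?_
  unfold W2 GG
  ring

lemma W1_dy : HasDerivAt (fun y => W1 x y)
    (2 * (GG x y * ((√(y - x))⁻¹ - (y - 2 * x) * (((√(y - x))⁻¹) ^ 3 / 2)))
      + 1 / 2 * (-W2 x y + GG x y * (- x * (((√(y - x))⁻¹) ^ 3)))) y := by
  refine (((B_dy x y h).const_mul 2).fun_add ((C_dy x y h).const_mul (1 / 2))).congr_deriv ?_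
  unfold W2 GG
  ring

lemma W2_dx : HasDerivAt (fun x => W2 x y)
    (1 / 2 * (-W2 x y + GG x y * (2 * (√(y - x))⁻¹ + x * (((√(y - x))⁻¹) ^ 3)))) x := by
  refine (((C_dx x y h).const_mul (1 / 2))).congr_deriv ?_
  unfold W2 GG
  ring

lemma W2_dy : HasDerivAt (fun y => W2 x y)
    (1 / 2 * (-W2 x y + GG x y * (- x * (((√(y - x))⁻¹) ^ 3)))) y := by
  refine (((C_dy x y h).const_mul (1 / 2))).congr_deriv ?_
  unfold W2 GG
  ring

lemma W_mixed : deriv (fun x => W2 x y) x = deriv (fun y => W1 x y) y := by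
  rw [(W2_dx x y h).deriv, (W1_dy x y h).deriv]
  linear_combination (GG x y * (√(y - x))⁻¹) * r_sq x y h

lemma W_pde : 1 / 2 * deriv (fun x => W1 x y) x + 1 / 2 * deriv (fun y => W2 x y) y
    + deriv (fun y => W1 x y) y + W1 x y = 0 := by
  rw [(W1_dx x y h).deriv, (W1_dy x y h).deriv, (W2_dy x y h).deriv]
  unfold W1 W2
  linear_combination (-1 / 2 * GG x y * (√(y - x))⁻¹) * r_sq x y h

lemma W2_le_W1 : W2 x y ≤ W1 x y := by
  unfold W1 W2
  have h1 := Phi_nonneg ((y - 2 * x) * (√(y - x))⁻¹)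
  have h2 := Real.exp_pos (-2 * x)
  have := mul_nonneg h2.le h1
  linarith

lemma Vx_lt : Vx x y = W1 x y := by
  refine HasDerivAt.deriv ((WW_dx x y h).congr_of_eventuallyEq ?_)
  filter_upwards [Iio_mem_nhds h] with u hu
  exact Vfun_lt u y hu

lemma Vy_lt : Vy x y = W2 x y := by
  refine HasDerivAt.deriv ((WW_dy x y h).congr_of_eventuallyEq ?_)
  filter_upwards [Ioi_mem_nhds h] with u hu
  exact Vfun_lt x u hu

end derivs2

lemma Vx_symm (x y : ℝ) : Vx x y = Vy y x := by
  unfold Vx Vy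
  congr 1
  ext u
  exact Vfun_symm u y

lemma pde_lt (x y : ℝ) (h : x < y) :
    1 / 2 * Vxx x y + 1 / 2 * Vyy x y + Vxy x y + max (Vx x y) (Vy x y) = 0 := by
  have e1 : Vxx x y = deriv (fun x => W1 x y) x := by
    refine Filter.EventuallyEq.deriv_eq ?_
    filter_upwards [Iio_mem_nhds h] with u hu
    exact Vx_lt u y hu
  have e2 : Vyy x y = deriv (fun y => W2 x y) y := by
    refine Filter.EventuallyEq.deriv_eq ?_
    filter_upwards [Ioi_mem_nhds h] with u hu
    exact Vy_lt x u hu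
  have e3 : Vxy x y = deriv (fun y => W1 x y) y := by
    refine Filter.EventuallyEq.deriv_eq ?_
    filter_upwards [Ioi_mem_nhds h] with u hu
    exact Vx_lt x u hu
  rw [e1, e2, e3, Vx_lt x y h, Vy_lt x y h, max_eq_left (W2_le_W1 x y h)]
  exact W_pde x y h

lemma pde_gt (x y : ℝ) (h : y < x) :
    1 / 2 * Vxx x y + 1 / 2 * Vyy x y + Vxy x y + max (Vx x y) (Vy x y) = 0 := by
  have e1 : Vxx x y = deriv (fun x => W2 y x) x := by
    refine Filter.EventuallyEq.deriv_eq ?_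
    filter_upwards [Ioi_mem_nhds h] with u hu
    rw [Vx_symm]
    exact Vy_lt y u hu
  have e2 : Vyy x y = deriv (fun y => W1 y x) y := by
    refine Filter.EventuallyEq.deriv_eq ?_
    filter_upwards [Iio_mem_nhds h] with u hu
    rw [← Vx_symm]
    exact Vx_lt u x hu
  have e3 : Vxy x y = deriv (fun x => W1 y x) x := by
    rw [← W_mixed y x h]
    refine Filter.EventuallyEq.deriv_eq ?_
    filter_upwards [Iio_mem_nhds h] with u hu
    rw [Vx_symm]
    exact Vy_lt u x hu
  rw [e1, e2, e3, ← Vx_symm y x, Vx_symm x y, Vx_lt y x h, Vy_lt y x h,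
    max_eq_right (W2_le_W1 y x h)]
  linear_combination W_pde y x h

lemma partial_contDiff1 (n : WithTop ℕ∞) (U : Set (ℝ × ℝ)) (hU : IsOpen U) (g : ℝ × ℝ → ℝ)
    (hg : ContDiffOn ℝ (n + 1) g U) :
    ContDiffOn ℝ n (fun p : ℝ × ℝ => deriv (fun x => g (x, p.2)) p.1) U := by
  have h := (contDiffOn_succ_iff_fderiv_of_isOpen hU).1 hg
  refine (h.2.2.clm_apply (contDiffOn_const (c := ((1 : ℝ), (0 : ℝ))))).congr fun p hp => ?_
  have h1 := (h.1.differentiableAt (hU.mem_nhds hp)).hasFDerivAt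
  have h2 : HasDerivAt (fun x : ℝ => (x, p.2)) (1, 0) p.1 :=
    (hasDerivAt_id _).prodMk (hasDerivAt_const _ _)
  exact (HasFDerivAt.comp_hasDerivAt (f := fun x : ℝ => (x, p.2)) p.1 h1 h2).deriv

lemma partial_contDiff2 (n : WithTop ℕ∞) (U : Set (ℝ × ℝ)) (hU : IsOpen U) (g : ℝ × ℝ → ℝ)
    (hg : ContDiffOn ℝ (n + 1) g U) :
    ContDiffOn ℝ n (fun p : ℝ × ℝ => deriv (fun y => g (p.1, y)) p.2) U := by
  have h := (contDiffOn_succ_iff_fderiv_of_isOpen hU).1 hg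
  refine (h.2.2.clm_apply (contDiffOn_const (c := ((0 : ℝ), (1 : ℝ))))).congr fun p hp => ?_
  have h1 := (h.1.differentiableAt (hU.mem_nhds hp)).hasFDerivAt
  have h2 : HasDerivAt (fun y : ℝ => (p.1, y)) (0, 1) p.2 :=
    (hasDerivAt_const _ _).prodMk (hasDerivAt_id _)
  exact (HasFDerivAt.comp_hasDerivAt (f := fun y : ℝ => (p.1, y)) p.2 h1 h2).deriv

lemma pde_all (x y : ℝ) (hx : 0 < x) (hy : 0 < y) :
    1 / 2 * Vxx x y + 1 / 2 * Vyy x y + Vxy x y + max (Vx x y) (Vy x y) = 0 := by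
  rcases lt_trichotomy x y with h | h | h
  · exact pde_lt x y h
  · subst h
    have hU : IsOpen (Set.Ioi (0 : ℝ) ×ˢ Set.Ioi (0 : ℝ)) := isOpen_Ioi.prod isOpen_Ioi
    have h0 : ContDiffOn ℝ (1 + 1) (fun p : ℝ × ℝ => Vfun p.1 p.2)
      (Set.Ioi (0 : ℝ) ×ˢ Set.Ioi (0 : ℝ)) := by
      rw [one_add_one_eq_two]; exact V_contDiff
    have v1 : ContDiffOn ℝ (0 + 1) (fun p : ℝ × ℝ => Vx p.1 p.2)
      (Set.Ioi (0 : ℝ) ×ˢ Set.Ioi (0 : ℝ)) := by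
      rw [zero_add]; exact partial_contDiff1 1 _ hU _ h0
    have v2 : ContDiffOn ℝ (0 + 1) (fun p : ℝ × ℝ => Vy p.1 p.2)
      (Set.Ioi (0 : ℝ) ×ˢ Set.Ioi (0 : ℝ)) := by
      rw [zero_add]; exact partial_contDiff2 1 _ hU _ h0
    have v11 : ContinuousOn (fun p : ℝ × ℝ => Vxx p.1 p.2)
      (Set.Ioi (0 : ℝ) ×ˢ Set.Ioi (0 : ℝ)) := (partial_contDiff1 0 _ hU _ v1).continuousOn
    have v12 : ContinuousOn (fun p : ℝ × ℝ => Vxy p.1 p.2)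
      (Set.Ioi (0 : ℝ) ×ˢ Set.Ioi (0 : ℝ)) := (partial_contDiff2 0 _ hU _ v1).continuousOn
    have v22 : ContinuousOn (fun p : ℝ × ℝ => Vyy p.1 p.2)
      (Set.Ioi (0 : ℝ) ×ˢ Set.Ioi (0 : ℝ)) := (partial_contDiff2 0 _ hU _ v2).continuousOn
    have c : ContinuousOn (fun p : ℝ × ℝ => 1 / 2 * Vxx p.1 p.2 + 1 / 2 * Vyy p.1 p.2
        + Vxy p.1 p.2 + max (Vx p.1 p.2) (Vy p.1 p.2)) (Set.Ioi (0 : ℝ) ×ˢ Set.Ioi (0 : ℝ)) :=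
      (((continuousOn_const.mul v11).add (continuousOn_const.mul v22)).add v12).add
        (v1.continuousOn.sup v2.continuousOn)
    have ca := c.continuousAt (hU.mem_nhds (⟨hx, hy⟩ : (x, x) ∈ Set.Ioi (0 : ℝ) ×ˢ Set.Ioi (0 : ℝ)))
    have cb : ContinuousAt (fun y : ℝ => 1 / 2 * Vxx x y + 1 / 2 * Vyy x y
        + Vxy x y + max (Vx x y) (Vy x y)) x :=
      ContinuousAt.comp (f := fun y : ℝ => (x, y)) ca (by fun_prop)
    have t1 := cb.tendsto.mono_left (nhdsWithin_le_nhds (s := Set.Ioi x))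
    refine tendsto_nhds_unique t1 (tendsto_const_nhds.congr' ?_)
    filter_upwards [self_mem_nhdsWithin] with u hu
    exact (pde_lt x u hu).symm
  · exact pde_gt x y h

lemma W_bound (x y : ℝ) (hx : 0 < x) (h : x < y) : |WW x y| ≤ 3 * x := by
  set t := y - x with ht
  set r := (√t)⁻¹ with hr
  have tp : 0 < t := sub_pos.2 h
  have key : ∀ m : ℝ, HasDerivAt (fun m => WW m (m + t))
      (2 * (Real.exp (-2 * m) * Phi ((m + t - 2 * m) * r))
        + Real.exp (-(m + (m + t)) / 2) * (2 * Phi (m * r) - 1)) m := by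
    intro m
    have hm : m < m + t := by linarith
    have rel1 := gphi_rel1 m (m + t) hm
    have rel2 := gphi_rel2 m (m + t) hm
    have et : ∀ m : ℝ, m + t - m = t := fun m => by ring
    unfold WW
    simp only [et] at rel1 rel2 ⊢
    rw [← hr] at rel1 rel2 ⊢
    have d1 : HasDerivAt (fun m : ℝ => (m + t) * r) r m := by
      simpa using ((hasDerivAt_id m).add_const t).mul_const r
    have d2 : HasDerivAt (fun m : ℝ => (m + t - 2 * m) * r) (-r) m := by
      refine ((((hasDerivAt_id m).add_const t).fun_sub
        ((hasDerivAt_id m).const_mul 2)).mul_const r).congr_deriv ?_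
      ring
    have d3 : HasDerivAt (fun m : ℝ => m * r) r m := by
      simpa using (hasDerivAt_id m).mul_const r
    have e1 : HasDerivAt (fun x : ℝ => -2 * x) (-2) m := by
      simpa using (hasDerivAt_id m).const_mul (-2 : ℝ)
    have e2 : HasDerivAt (fun m : ℝ => -(m + (m + t)) / 2) (-1) m := by
      refine ((((hasDerivAt_id m).fun_add ((hasDerivAt_id m).add_const t)).fun_neg).div_const
        2).congr_deriv ?_
      ring
    refine ((((Phi_hasDerivAt _).comp m d1).fun_sub (e1.exp.fun_mul
      ((Phi_hasDerivAt _).comp m d2))).fun_sub (e2.exp.fun_mul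
      ((((Phi_hasDerivAt _).comp m d3).const_mul 2).sub_const 1))).congr_deriv ?_
    simp only [Function.comp]
    linear_combination r * rel1 + r * rel2
  have bd : ∀ m ∈ Set.Icc 0 x, ‖2 * (Real.exp (-2 * m) * Phi ((m + t - 2 * m) * r))
        + Real.exp (-(m + (m + t)) / 2) * (2 * Phi (m * r) - 1)‖ ≤ 3 := by
    rintro m ⟨hm, -⟩
    have a1 : Real.exp (-2 * m) ≤ 1 := Real.exp_le_one_iff.2 (by linarith)
    have a2 : Real.exp (-(m + (m + t)) / 2) ≤ 1 := Real.exp_le_one_iff.2 (by linarith)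
    have a3 := Real.exp_pos (-2 * m)
    have a4 := Real.exp_pos (-(m + (m + t)) / 2)
    have b1 := Phi_nonneg ((m + t - 2 * m) * r)
    have b2 := Phi_le_one ((m + t - 2 * m) * r)
    have b3 := Phi_nonneg (m * r)
    have b4 := Phi_le_one (m * r)
    rw [Real.norm_eq_abs]
    have c1 : |Real.exp (-2 * m) * Phi ((m + t - 2 * m) * r)| ≤ 1 := by
      rw [abs_mul, abs_of_pos a3, abs_of_nonneg b1]
      exact mul_le_one₀ a1 b1 b2
    have c2 : |Real.exp (-(m + (m + t)) / 2) * (2 * Phi (m * r) - 1)| ≤ 1 := by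
      rw [abs_mul, abs_of_pos a4]
      exact mul_le_one₀ a2 (abs_nonneg _) (abs_le.2 ⟨by linarith, by linarith⟩)
    rw [abs_le] at *
    constructor <;> linarith [c1.1, c1.2, c2.1, c2.2]
  have mv := (convex_Icc 0 x).norm_image_sub_le_of_norm_hasDerivWithin_le
    (fun m _ => (key m).hasDerivWithinAt) bd (left_mem_Icc.2 hx.le) (right_mem_Icc.2 hx.le)
  have z : WW 0 (0 + t) = 0 := by
    unfold WW
    simp [Phi_zero]
  have e : x + t = y := by rw [ht]; ring
  simp only [z, e, sub_zero, Real.norm_eq_abs, abs_of_pos hx] at mv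
  exact mv

lemma V_bound (x y : ℝ) (hx : 0 < x) (hy : 0 < y) : |Vfun x y| ≤ 3 * min x y := by
  rcases lt_trichotomy x y with h | h | h
  · rw [Vfun_lt x y h, min_eq_left h.le]
    exact W_bound x y hx h
  · subst h
    unfold Vfun
    rw [if_pos rfl, min_self]
    have h1 : Real.exp (-x) ≤ 1 := Real.exp_le_one_iff.2 (by linarith)
    have h2 := Real.add_one_le_exp (-x)
    rw [abs_le]
    constructor <;> linarith
  · rw [Vfun_symm, Vfun_lt y x h, min_eq_right h.le]
    exact W_bound y x hy h

open Classical in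
/-- Continuous extension. -/
noncomputable def VB (p : ℝ × ℝ) : ℝ := if 0 < p.1 ∧ 0 < p.2 then Vfun p.1 p.2 else 0

lemma VB_bound (p : ℝ × ℝ) (h : p ∈ Set.Ici (0 : ℝ) ×ˢ Set.Ici (0 : ℝ)) :
    |VB p| ≤ 3 * min p.1 p.2 := by
  unfold VB
  split_ifs with hp
  · exact V_bound _ _ hp.1 hp.2
  · have : 0 ≤ min p.1 p.2 := le_min h.1 h.2
    rw [abs_zero]
    positivity

lemma VB_cont : ContinuousOn VB (Set.Ici (0 : ℝ) ×ˢ Set.Ici (0 : ℝ)) := by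
  intro p hp
  by_cases h : 0 < p.1 ∧ 0 < p.2
  · have hU : IsOpen (Set.Ioi (0 : ℝ) ×ˢ Set.Ioi (0 : ℝ)) := isOpen_Ioi.prod isOpen_Ioi
    have hm : p ∈ (Set.Ioi (0 : ℝ) ×ˢ Set.Ioi (0 : ℝ)) := h
    refine ContinuousAt.continuousWithinAt ?_
    refine (V_contDiff.continuousOn.continuousAt (hU.mem_nhds hm)).congr ?_
    filter_upwards [hU.mem_nhds hm] with q hq
    exact (if_pos hq).symm
  · have hmin : min p.1 p.2 = 0 := by
      refine le_antisymm ?_ (le_min hp.1 hp.2)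
      by_contra hc
      exact h (lt_min_iff.1 (not_le.1 hc))
    have h0 : VB p = 0 := if_neg h
    unfold ContinuousWithinAt
    rw [h0]
    have hl : Tendsto (fun q : ℝ × ℝ => 3 * min q.1 q.2) (𝓝 p) (𝓝 (3 * min p.1 p.2)) :=
      (continuous_const.mul (continuous_fst.min continuous_snd)).tendsto p
    rw [hmin, mul_zero] at hl
    refine squeeze_zero_norm' ?_ (hl.mono_left nhdsWithin_le_nhds)
    filter_upwards [self_mem_nhdsWithin] with q hq
    exact VB_bound q hq

theorem stmt8 :
    ContDiffOn ℝ 2 (fun p : ℝ × ℝ => Vfun p.1 p.2) (Set.Ioi (0 : ℝ) ×ˢ Set.Ioi (0 : ℝ))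
    ∧ (∃ Vbar : ℝ × ℝ → ℝ,
        ContinuousOn Vbar (Set.Ici (0 : ℝ) ×ˢ Set.Ici (0 : ℝ))
        ∧ (∀ x y : ℝ, 0 < x → 0 < y → Vbar (x, y) = Vfun x y)
        ∧ (∀ x : ℝ, 0 ≤ x → Vbar (x, 0) = 0)
        ∧ (∀ y : ℝ, 0 ≤ y → Vbar (0, y) = 0))
    ∧ (∀ x y : ℝ, 0 < x → 0 < y →
        1 / 2 * Vxx x y + 1 / 2 * Vyy x y + Vxy x y + max (Vx x y) (Vy x y) = 0) := by
  exact ⟨V_contDiff, ⟨VB, VB_cont, fun x y hx hy => if_pos ⟨hx, hy⟩,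
    fun x _ => if_neg (fun h => lt_irrefl _ h.2), fun y _ => if_neg (fun h => lt_irrefl _ h.1)⟩,
    pde_all⟩
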